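/- Let N ≥ 2 and let E_1 < γ_1 < E_2 < ⋯ < γ_{N−1} < E_N be real, r_i = Π_{s=1}^{N−1}(E_i − γ_s). For t ∈ ℝ and 0 ≤ n ≤ N−1 let M(t,n) be the N×(N+1) matrix with entries M(t,n)_{ij} = r_i e^{E_i t} E_i^j for 0 ≤ j ≤ n and M(t,n)_{ij} = −E_i^{j−n−1} for n+1 ≤ j ≤ N, and let Δ_j(t,n) be the determinant of M(t,n) with column j deleted. Then for every t the ratio Δ_n(t,n)/Δ_N(t,n) is nonzero of constant sign, and for any constant C the functions q_n(t) = C + ln( Δ_n(t,n)/Δ_N(t,n) ) (n = 0,…,N−1) are smooth and solve the open Toda lattice equations: q̈_0 = −e^{q_0−q_1}; q̈_n = e^{q_{n−1}−q_n} − e^{q_n−q_{n+1}} for 1 ≤ n ≤ N−2; q̈_{N−1} = e^{q_{N−2}−q_{N−1}}. -/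

import Mathlib

open Matrix

theorem hasDerivAt_det_sum_updateRow {ι : Type*} [Fintype ι] [DecidableEq ι]
    {A : ℝ → Matrix ι ι ℝ} {A' : Matrix ι ι ℝ} {t : ℝ}
    (hA : ∀ i j, HasDerivAt (fun s => A s i j) (A' i j) t) :
    HasDerivAt (fun s => (A s).det) (∑ i, ((A t).updateRow i (A' i)).det) t := by
  have h : HasDerivAt (fun s => (A s)ᵀ.det)
      (∑ σ : Equiv.Perm ι, (Equiv.Perm.sign σ : ℝ) *
        ∑ i, (∏ j ∈ Finset.univ.erase i, A t j (σ j)) • A' i (σ i)) t := by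
    simp only [det_apply']
    exact HasDerivAt.fun_sum fun σ _ =>
      (HasDerivAt.fun_finsetProd fun i _ => hA i (σ i)).const_mul _
  simp only [det_transpose] at h
  convert h using 1
  simp only [Finset.mul_sum]
  rw [Finset.sum_comm]
  refine Finset.sum_congr rfl fun i _ => ?_
  rw [← det_transpose, det_apply']
  refine Finset.sum_congr rfl fun σ _ => ?_
  rw [← Finset.mul_prod_erase _ _ (Finset.mem_univ i), smul_eq_mul, mul_comm (Finset.prod _ _)]
  congr 2
  · simp
  · refine Finset.prod_congr rfl fun j hj => ?_
    simp [Finset.ne_of_mem_erase hj]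

/-- The Desnanot–Jacobi identity for a matrix with a two-dimensional border. -/
theorem det_fromBlocks_mul_det {ι : Type*} [Fintype ι] [DecidableEq ι]
    (A : Matrix ι ι ℝ) (B : Matrix ι (Fin 2) ℝ) (C : Matrix (Fin 2) ι ℝ)
    (D : Matrix (Fin 2) (Fin 2) ℝ) (hA : A.det ≠ 0) :
    let minor : Fin 2 → Fin 2 → ℝ := fun i j =>
      (fromBlocks A (B.submatrix id ![j]) (C.submatrix ![i] id) (D.submatrix ![i] ![j])).det
    (fromBlocks A B C D).det * A.det = minor 0 0 * minor 1 1 - minor 0 1 * minor 1 0 := by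
  intro minor
  let : Invertible A := A.invertibleOfIsUnitDet (isUnit_iff_ne_zero.mpr hA)
  have h : ∀ i j, minor i j = A.det * (D - C * ⅟A * B) i j := by
    intro i j
    simp only [minor]
    rw [det_fromBlocks₁₁, det_fin_one]
    rfl
  rw [h, h, h, h, det_fromBlocks₁₁, det_fin_two]
  ring

/-- The Hankel matrix of order `k` of a moment sequence. -/
def hankel (m : ℕ → ℝ) (k : ℕ) : Matrix (Fin k) (Fin k) ℝ := of fun a b => m (a + b)

/-- The index of a row of a Hankel matrix whose last row, in position `p`, is shifted by `a`. -/
def borderIndex (p a : ℕ) : Fin p ⊕ Fin 1 → ℕ := Sum.elim (fun i => i) fun _ => p + a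

/-- The Hankel matrix of order `p + 1` with its last row shifted by `a` and its last column
shifted by `b`. -/
def borderedHankel (m : ℕ → ℝ) (p a b : ℕ) : Matrix (Fin p ⊕ Fin 1) (Fin p ⊕ Fin 1) ℝ :=
  of fun i j => m (borderIndex p a i + borderIndex p b j)

theorem det_hankel_succ (m : ℕ → ℝ) (p : ℕ) :
    (hankel m (p + 1)).det = (borderedHankel m p 0 0).det := by
  rw [← det_submatrix_equiv_self finSumFinEquiv]
  congr 1
  ext (i | i) (j | j) <;> simp [hankel, borderedHankel, borderIndex]

theorem det_borderedHankel_comm (m : ℕ → ℝ) (p a b : ℕ) :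
    (borderedHankel m p a b).det = (borderedHankel m p b a).det := by
  rw [← det_transpose]
  congr 1
  ext i j
  simp [borderedHankel, add_comm]

theorem det_hankel_add_two_mul (m : ℕ → ℝ) (p : ℕ) (h : (hankel m p).det ≠ 0) :
    (hankel m (p + 2)).det * (hankel m p).det =
      (borderedHankel m p 0 0).det * (borderedHankel m p 1 1).det -
        (borderedHankel m p 0 1).det * (borderedHankel m p 1 0).det := by
  have key := det_fromBlocks_mul_det (hankel m p) (of fun i (j : Fin 2) => m (i + (p + j)))
    (of fun (i : Fin 2) j => m (p + i + j)) (of fun i j => m (p + i + (p + j))) h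
  convert key using 1
  · rw [← det_submatrix_equiv_self finSumFinEquiv]
    congr 2
    ext (i | i) (j | j) <;> simp [hankel]
  · have hminor : ∀ a b : Fin 2, borderedHankel m p a b =
        fromBlocks (hankel m p) ((of fun (i : Fin p) (j : Fin 2) => m (i + (p + j))).submatrix id ![b])
          ((of fun (i : Fin 2) (j : Fin p) => m (p + i + j)).submatrix ![a] id)
          ((of fun i j : Fin 2 => m (p + i + (p + j))).submatrix ![a] ![b]) := by
      intro a b
      ext (i | i) (j | j) <;>
        simp only [fromBlocks_apply₁₁, fromBlocks_apply₁₂, fromBlocks_apply₂₁, fromBlocks_apply₂₂,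
          submatrix_apply, cons_val_fin_one, id, of_apply, hankel, borderedHankel, borderIndex,
          Sum.elim_inl, Sum.elim_inr]
    simp only [← hminor]
    simp

theorem hasDerivAt_det_borderedHankel_zero {m : ℕ → ℝ → ℝ}
    (hm : ∀ s t, HasDerivAt (m s) (m (s + 1) t) t) (p b : ℕ) (t : ℝ) :
    HasDerivAt (fun t => (borderedHankel (fun s => m s t) p 0 b).det)
      (borderedHankel (fun s => m s t) p 1 b).det t := by
  convert hasDerivAt_det_sum_updateRow (A := fun t => borderedHankel (fun s => m s t) p 0 b)
    (A' := of fun i j => m (borderIndex p 0 i + borderIndex p b j + 1) t) (t := t)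
    (fun i j => hm _ t) using 1
  rw [Fintype.sum_sum_type, Finset.sum_eq_zero, zero_add, Fin.sum_univ_one]
  · congr 1
    ext (i | i) j
    · simp [borderedHankel, borderIndex]
    · obtain rfl := Subsingleton.elim i 0
      simp only [borderedHankel, borderIndex, of_apply, Sum.elim_inr, updateRow_self]
      ring_nf
  · intro i _
    obtain ⟨i', hne, hi'⟩ : ∃ i', i' ≠ Sum.inl i ∧ borderIndex p 0 i' = i + 1 := by
      by_cases h : (i : ℕ) + 1 < p
      · refine ⟨Sum.inl ⟨i + 1, h⟩, ?_, rfl⟩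
        simp [Fin.ext_iff]
      · exact ⟨Sum.inr 0, by simp, by simp [borderIndex]; omega⟩
    refine det_zero_of_row_eq hne (funext fun j => ?_)
    rw [updateRow_ne hne, updateRow_self]
    simp only [borderedHankel, of_apply, hi']
    simp only [borderIndex, Sum.elim_inl]
    ring_nf

/-- The Hankel determinants of a moment sequence with `m s' = m (s + 1)` satisfy the Toda
equation in logarithmic form. -/
theorem exists_hasDerivAt_log_det_hankel {m : ℕ → ℝ → ℝ}
    (hm : ∀ s t, HasDerivAt (m s) (m (s + 1) t) t) (p : ℕ)
    (h₀ : ∀ t, (hankel (fun s => m s t) p).det ≠ 0)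
    (h₁ : ∀ t, (hankel (fun s => m s t) (p + 1)).det ≠ 0) :
    ∃ l : ℝ → ℝ,
      (∀ t, HasDerivAt (fun t => Real.log (hankel (fun s => m s t) (p + 1)).det) (l t) t) ∧
      ∀ t, HasDerivAt l ((hankel (fun s => m s t) p).det * (hankel (fun s => m s t) (p + 2)).det /
        (hankel (fun s => m s t) (p + 1)).det ^ 2) t := by
  simp only [det_hankel_succ _ p] at h₁ ⊢
  refine ⟨_, fun t => (hasDerivAt_det_borderedHankel_zero hm p 0 t).log (h₁ t), fun t => ?_⟩
  simp only [det_borderedHankel_comm _ p 1 0]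
  refine ((hasDerivAt_det_borderedHankel_zero hm p 1 t).fun_div
    (hasDerivAt_det_borderedHankel_zero hm p 0 t) (h₁ t)).congr_deriv ?_
  rw [mul_comm (hankel _ p).det, det_hankel_add_two_mul _ p (h₀ t)]
  ring

theorem contDiff_det_hankel {m : ℕ → ℝ → ℝ} (hm : ∀ s, ContDiff ℝ (⊤ : ℕ∞) (m s)) (k : ℕ) :
    ContDiff ℝ (⊤ : ℕ∞) fun t => (hankel (fun s => m s t) k).det := by
  simp only [det_apply']
  exact ContDiff.sum fun σ _ => contDiff_const.mul (contDiff_prod fun i _ => hm _)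

section Moments

variable {N : ℕ}

/-- The moments of the discrete measure with masses `w i` at the nodes `x i`. -/
def discreteMoment (x w : Fin N → ℝ) (s : ℕ) : ℝ := ∑ i, w i * x i ^ s

theorem hankel_discreteMoment (x w : Fin N → ℝ) (k : ℕ) :
    hankel (discreteMoment x w) k =
      (of fun i (a : Fin k) => x i ^ (a : ℕ))ᴴ * diagonal w * of fun i (a : Fin k) =>
        x i ^ (a : ℕ) := by
  ext a b
  rw [Matrix.mul_apply]
  simp only [hankel, discreteMoment, of_apply, mul_diagonal, conjTranspose_apply, star_trivial]
  exact Finset.sum_congr rfl fun i _ => by ring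

theorem det_hankel_discreteMoment_pos {x w : Fin N → ℝ} (hx : Function.Injective x)
    (hw : ∀ i, 0 < w i) {k : ℕ} (hk : k ≤ N) : 0 < (hankel (discreteMoment x w) k).det := by
  rw [hankel_discreteMoment]
  refine ((PosDef.diagonal hw).conjTranspose_mul_mul_same ?_).det_pos
  refine (injective_iff_map_eq_zero (of fun i (a : Fin k) => x i ^ (a : ℕ)).mulVecLin).2
    fun v hv => ?_
  refine eq_zero_of_forall_index_sum_pow_mul_eq_zero (f := fun j : Fin k => x (Fin.castLE hk j))
    (hx.comp (Fin.castLE_injective hk)) fun j => ?_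
  simpa [mulVec, dotProduct] using congrFun hv (Fin.castLE hk j)

theorem det_hankel_discreteMoment_eq_zero (x w : Fin N → ℝ) {k : ℕ} (hk : N < k) :
    (hankel (discreteMoment x w) k).det = 0 := by
  by_contra h
  have h₁ := rank_of_isUnit _ ((isUnit_iff_isUnit_det _).2 (isUnit_iff_ne_zero.2 h))
  rw [hankel_discreteMoment, Fintype.card_fin] at h₁
  have h₂ := h₁.symm.trans_le ((rank_mul_le_right _ _).trans (rank_le_card_height _))
  rw [Fintype.card_fin] at h₂
  omega

/-- The matrix whose row `a` evaluates the leading Lagrange coefficient of `X ^ a * P`. -/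
noncomputable def lagrangeMatrix (x : Fin N → ℝ) : Matrix (Fin N) (Fin N) ℝ :=
  of fun a i => x i ^ (a : ℕ) / ∏ j ∈ Finset.univ.erase i, (x i - x j)

theorem sum_pow_div_prod_sub {x : Fin N → ℝ} (hx : Function.Injective x) {s : ℕ} (hs : s < N) :
    ∑ i, x i ^ s / ∏ j ∈ Finset.univ.erase i, (x i - x j) = if s + 1 = N then 1 else 0 := by
  have := Lagrange.coeff_eq_sum (s := Finset.univ) (v := x) hx.injOn (P := Polynomial.X ^ s)
    (by simpa using hs)
  simp only [Polynomial.eval_pow, Polynomial.eval_X] at this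
  rw [← this, Polynomial.coeff_X_pow]
  simp only [Finset.card_univ, Fintype.card_fin]
  congr 1
  simp only [eq_iff_iff]
  omega

/-- The matrix with columns `w i * x i ^ j` for `j < k` and `-x i ^ (j - k)` for `k ≤ j`. -/
def splitVandermonde (x w : Fin N → ℝ) (k : ℕ) : Matrix (Fin N) (Fin N) ℝ :=
  of fun i j => if (j : ℕ) < k then w i * x i ^ (j : ℕ) else -x i ^ ((j : ℕ) - k)

theorem exists_mul_det_splitVandermonde {x : Fin N → ℝ} (hx : Function.Injective x)
    {k : ℕ} (hk : k ≤ N) :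
    ∃ c : ℝ, |c| = |(lagrangeMatrix x).det| ∧ ∀ w : Fin N → ℝ,
      c * (splitVandermonde x w k).det =
        (hankel (discreteMoment x fun i => w i / ∏ j ∈ Finset.univ.erase i, (x i - x j)) k).det := by
  obtain ⟨m, rfl⟩ := Nat.exists_eq_add_of_le hk
  let f : Fin k ⊕ Fin m ≃ Fin (k + m) := finSumFinEquiv
  let e : Fin k ⊕ Fin m ≃ Fin (k + m) := ((Equiv.refl _).sumCongr Fin.revPerm).trans f
  refine ⟨(-1) ^ m * ((lagrangeMatrix x).submatrix e f).det, ?_, fun w => ?_⟩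
  · simp [abs_mul]
  have hsum : ∀ s < k + m, ∑ i, (x i ^ s / ∏ j ∈ Finset.univ.erase i, (x i - x j)) =
    if s + 1 = k + m then 1 else 0 := fun s hs => sum_pow_div_prod_sub hx hs
  have hblock : (lagrangeMatrix x).submatrix e f * (splitVandermonde x w k).submatrix f f =
      (lagrangeMatrix x * splitVandermonde x w k).submatrix e f := submatrix_mul_equiv ..
  have hentry : ∀ (a : Fin (k + m)) (b : Fin m),
      (lagrangeMatrix x * splitVandermonde x w k) a (Fin.natAdd k b) =
        -∑ i, x i ^ ((a : ℕ) + b) / ∏ j ∈ Finset.univ.erase i, (x i - x j) := by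
    intro a b
    simp only [Matrix.mul_apply, lagrangeMatrix, splitVandermonde, of_apply, Fin.val_natAdd,
      ← Finset.sum_neg_distrib]
    refine Finset.sum_congr rfl fun i _ => ?_
    rw [if_neg (by omega), Nat.add_sub_cancel_left]
    ring
  have h₁₁ : ((lagrangeMatrix x * splitVandermonde x w k).submatrix e f).toBlocks₁₁ =
      hankel (discreteMoment x fun i => w i / ∏ j ∈ Finset.univ.erase i, (x i - x j)) k := by
    ext a b
    simp only [toBlocks₁₁, of_apply, submatrix_apply, Matrix.mul_apply, lagrangeMatrix,
      splitVandermonde, hankel, discreteMoment]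
    refine Finset.sum_congr rfl fun i _ => ?_
    simp [e, f]
    ring
  have h₁₂ : ((lagrangeMatrix x * splitVandermonde x w k).submatrix e f).toBlocks₁₂ = 0 := by
    ext a b
    simp only [toBlocks₁₂, of_apply, submatrix_apply]
    simp only [e, f, Equiv.trans_apply, Equiv.sumCongr_apply, Sum.map_inl, Equiv.refl_apply,
      finSumFinEquiv_apply_left, finSumFinEquiv_apply_right, hentry, Fin.val_castAdd]
    rw [hsum _ (by omega), if_neg (by omega)]
    simp
  have h₂₂ : ((lagrangeMatrix x * splitVandermonde x w k).submatrix e f).toBlocks₂₂.det =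
      (-1) ^ m := by
    have happ : ∀ a b, ((lagrangeMatrix x * splitVandermonde x w k).submatrix e f).toBlocks₂₂ a b =
        -∑ i, x i ^ (k + (m - (a + 1)) + b) / ∏ j ∈ Finset.univ.erase i, (x i - x j) := by
      intro a b
      simp only [toBlocks₂₂, of_apply, submatrix_apply]
      simp only [e, f, Equiv.trans_apply, Equiv.sumCongr_apply, Sum.map_inr, Fin.revPerm_apply,
        finSumFinEquiv_apply_right, hentry, Fin.val_natAdd, Fin.val_rev]
    rw [det_of_isUpperTriangular]
    · simp_rw [happ]
      rw [Finset.prod_congr rfl fun a _ => by rw [hsum _ (by omega), if_pos (by omega)]]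
      simp
    · intro a b hab
      have hab : b < a := hab
      rw [happ, hsum _ (by omega), if_neg (by omega), neg_zero]
  rw [← det_submatrix_equiv_self f (splitVandermonde x w k), mul_assoc, ← det_mul, hblock,
    ← fromBlocks_toBlocks ((lagrangeMatrix x * splitVandermonde x w k).submatrix e f), h₁₂,
    det_fromBlocks_zero₁₂, h₁₁, h₂₂, mul_comm, mul_assoc, ← mul_pow]
  simp

theorem hasDerivAt_discreteMoment_exp (x w : Fin N → ℝ) (s : ℕ) (t : ℝ) :
    HasDerivAt (fun t => discreteMoment x (fun i => w i * Real.exp (x i * t)) s)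
      (discreteMoment x (fun i => w i * Real.exp (x i * t)) (s + 1)) t := by
  refine HasDerivAt.fun_sum fun i _ => ?_
  refine ((((hasDerivAt_id t).const_mul (x i)).exp.const_mul (w i)).mul_const _).congr_deriv ?_
  simp only [id]
  ring

theorem contDiff_discreteMoment_exp (x w : Fin N → ℝ) (s : ℕ) :
    ContDiff ℝ (⊤ : ℕ∞) fun t => discreteMoment x (fun i => w i * Real.exp (x i * t)) s := by
  unfold discreteMoment
  fun_prop

end Moments

theorem interlacing_weight_pos {M : ℕ} {x : Fin (M + 1) → ℝ} {y : Fin M → ℝ}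
    (h : ∀ s : Fin M, x s.castSucc < y s ∧ y s < x s.succ) (i : Fin (M + 1)) :
    0 < (∏ s, (x i - y s)) / ∏ j ∈ Finset.univ.erase i, (x i - x j) := by
  have hx : StrictMono x := Fin.strictMono_iff_lt_succ.2 fun s => (h s).1.trans (h s).2
  have herase : Finset.univ.erase i = Finset.univ.map i.succAboveEmb := by
    ext j
    simp [Fin.exists_succAbove_eq_iff]
  rw [herase, Finset.prod_map, ← Finset.prod_div_distrib]
  refine Finset.prod_pos fun s _ => ?_
  simp only [Fin.coe_succAboveEmb]
  rcases lt_or_ge s.castSucc i with hs | hs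
  · rw [Fin.succAbove_of_castSucc_lt _ _ hs]
    have := hx.monotone (Fin.castSucc_lt_iff_succ_le.1 hs)
    exact div_pos (by linarith [(h s).2]) (sub_pos.2 (hx hs))
  · rw [Fin.succAbove_of_le_castSucc _ _ hs]
    have := hx.monotone hs
    exact div_pos_of_neg_of_neg (by linarith [(h s).1]) (by linarith [(h s).1, (h s).2])

/-- The functions `C + log (H n / H (n + 1))`, up to a sign in the argument of the logarithm, solve
the open Toda equations as soon as every `log (H k)` has second derivative
`H (k - 1) * H (k + 1) / H k ^ 2`, with the boundary conditions `H (-1) = H (N + 1) = 0`. -/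
theorem open_toda_of_tau {N : ℕ} (hN : 2 ≤ N) {H R : ℕ → ℝ → ℝ}
    (hpos : ∀ k ≤ N, ∀ t, 0 < H k t) (hsmooth : ∀ k, ContDiff ℝ (⊤ : ℕ∞) (H k))
    (hzero : ∀ t, H 0 t = 1) (hlast : ∀ t, H (N + 1) t = 0)
    (hlog : ∀ k < N, ∃ l : ℝ → ℝ, (∀ t, HasDerivAt (fun t => Real.log (H (k + 1) t)) (l t) t) ∧
      ∀ t, HasDerivAt l (H k t * H (k + 2) t / H (k + 1) t ^ 2) t)
    (hR : ∀ n < N, ∃ ε : ℝ, |ε| = 1 ∧ ∀ t, R n t = ε * (H n t / H (n + 1) t)) (C : ℝ) :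
    let q : ℕ → ℝ → ℝ := fun n t => C + Real.log (R n t)
    (∀ n ≤ N - 1, (∀ t : ℝ, R n t ≠ 0) ∧ ((∀ t : ℝ, 0 < R n t) ∨ (∀ t : ℝ, R n t < 0))) ∧
    (∀ n ≤ N - 1, ContDiff ℝ (⊤ : ℕ∞) (q n)) ∧
    (∀ t : ℝ, deriv (deriv (q 0)) t = -Real.exp (q 0 t - q 1 t)) ∧
    (∀ n, 1 ≤ n → n ≤ N - 2 → ∀ t : ℝ,
      deriv (deriv (q n)) t
        = Real.exp (q (n - 1) t - q n t) - Real.exp (q n t - q (n + 1) t)) ∧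
    (∀ t : ℝ, deriv (deriv (q (N - 1))) t = Real.exp (q (N - 2) t - q (N - 1) t)) := by
  intro q
  have hq : ∀ n < N, q n = fun t => C + (Real.log (H n t) - Real.log (H (n + 1) t)) := by
    intro n hn
    obtain ⟨ε, hε, hRn⟩ := hR n hn
    funext t
    simp only [q]
    rw [hRn, ← Real.log_abs, abs_mul, hε, one_mul, Real.log_abs,
      Real.log_div (hpos n hn.le t).ne' (hpos (n + 1) hn t).ne']
  have hexp : ∀ n, n + 1 < N → ∀ t, Real.exp (q n t - q (n + 1) t) =
      H n t * H (n + 2) t / H (n + 1) t ^ 2 := by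
    intro n hn t
    have h₀ := hpos n (by omega) t
    have h₁ := hpos (n + 1) (by omega) t
    have h₂ := hpos (n + 2) (by omega) t
    rw [hq n (by omega), hq (n + 1) hn, ← Real.exp_log (show 0 < H n t * H (n + 2) t / H (n + 1) t ^ 2 by positivity),
      Real.log_div (by positivity) (by positivity), Real.log_mul h₀.ne' h₂.ne', Real.log_pow]
    congr 1
    push_cast
    ring
  let S : ℕ → ℝ → ℝ := fun k t =>
    if k = 0 then 0 else H (k - 1) t * H (k + 1) t / H k t ^ 2
  have hS : ∀ k ≤ N, ∃ l : ℝ → ℝ, (∀ t, HasDerivAt (fun t => Real.log (H k t)) (l t) t) ∧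
      ∀ t, HasDerivAt l (S k t) t := by
    rintro (_ | k) hk
    · refine ⟨fun _ => 0, fun t => ?_, fun t => ?_⟩
      · simpa [hzero] using hasDerivAt_const t (0 : ℝ)
      · simpa [S] using hasDerivAt_const t (0 : ℝ)
    · simpa [S] using hlog k hk
  have hderiv : ∀ n < N, ∀ t, deriv (deriv (q n)) t = S n t - S (n + 1) t := by
    intro n hn t
    obtain ⟨l, hl, hl'⟩ := hS n hn.le
    obtain ⟨l₁, hl₁, hl₁'⟩ := hS (n + 1) hn
    have h : deriv (q n) = fun t => l t - l₁ t := by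
      rw [hq n hn]
      exact funext fun t => (((hl t).fun_sub (hl₁ t)).const_add C).deriv
    rw [h]
    exact ((hl' t).fun_sub (hl₁' t)).deriv
  refine ⟨fun n hn => ?_, fun n hn => ?_, fun t => ?_, fun n h₁ h₂ t => ?_, fun t => ?_⟩
  · obtain ⟨ε, hε, hRn⟩ := hR n (by omega)
    have hquot : ∀ t, 0 < H n t / H (n + 1) t := fun t =>
      div_pos (hpos n (by omega) t) (hpos (n + 1) (by omega) t)
    have hε₀ : ε ≠ 0 := by
      rintro rfl
      simp at hε
    simp only [hRn]
    refine ⟨fun t => mul_ne_zero hε₀ (hquot t).ne', hε₀.lt_or_gt.symm.imp ?_ ?_⟩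
    · exact fun h t => mul_pos h (hquot t)
    · exact fun h t => mul_neg_of_neg_of_pos h (hquot t)
  · rw [hq n (by omega)]
    exact contDiff_const.add (((hsmooth n).log fun t => (hpos n (by omega) t).ne').sub
      ((hsmooth (n + 1)).log fun t => (hpos (n + 1) (by omega) t).ne'))
  · rw [hderiv 0 (by omega), hexp 0 (by omega)]
    simp [S]
  · obtain ⟨n, rfl⟩ := Nat.exists_eq_add_of_le' h₁
    rw [hderiv (n + 1) (by omega), hexp (n + 1) (by omega), Nat.add_sub_cancel, hexp n (by omega)]
    simp [S]
  · obtain ⟨n, rfl⟩ := Nat.exists_eq_add_of_le' hN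
    rw [show n + 2 - 1 = n + 1 from rfl, show n + 2 - 2 = n from rfl, hderiv (n + 1) (by omega),
      hexp n (by omega)]
    have := hlast t
    simp only [add_assoc, Nat.reduceAdd] at this
    simp [S, this, add_assoc]

/-- The functions `qₙ(t) = C + ln(Δₙ(t,n)/Δ_N(t,n))` built from the
time-dependent minors of the matrix `M(t,n)` are well defined (the ratio is
nonzero of constant sign), smooth, and solve the open Toda lattice equations. -/
theorem open_toda_explicit_solution (N : ℕ) (hN : 2 ≤ N)
    (E γ : ℕ → ℝ)
    (hint : ∀ k, 1 ≤ k → k ≤ N - 1 → E k < γ k ∧ γ k < E (k + 1)) :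
    (let r : ℕ → ℝ := fun i => ∏ s ∈ Finset.Icc 1 (N - 1), (E i - γ s)
    let M : ℝ → ℕ → Matrix (Fin N) (Fin (N + 1)) ℝ := fun t n =>
      Matrix.of fun i j =>
        if (j : ℕ) ≤ n then
          r ((i : ℕ) + 1) * Real.exp (E ((i : ℕ) + 1) * t) * (E ((i : ℕ) + 1)) ^ (j : ℕ)
        else -(E ((i : ℕ) + 1)) ^ ((j : ℕ) - n - 1)
    -- Δ' j t n : determinant of M(t,n) with column j deleted
    let Δ' : ℕ → ℝ → ℕ → ℝ := fun j t n =>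
      if h : j < N + 1 then Matrix.det ((M t n).submatrix id (Fin.succAbove ⟨j, h⟩))
      else 0
    ∀ C : ℝ,
    let q : ℕ → ℝ → ℝ := fun n t => C + Real.log (Δ' n t n / Δ' N t n)
    -- the ratio is nonzero of constant sign
    (∀ n ≤ N - 1, (∀ t : ℝ, Δ' n t n / Δ' N t n ≠ 0) ∧
      ((∀ t : ℝ, 0 < Δ' n t n / Δ' N t n) ∨ (∀ t : ℝ, Δ' n t n / Δ' N t n < 0))) ∧
    -- smoothness
    (∀ n ≤ N - 1, ContDiff ℝ (⊤ : ℕ∞) (q n)) ∧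
    -- the open Toda lattice equations
    (∀ t : ℝ, deriv (deriv (q 0)) t = -Real.exp (q 0 t - q 1 t)) ∧
    (∀ n, 1 ≤ n → n ≤ N - 2 → ∀ t : ℝ,
      deriv (deriv (q n)) t
        = Real.exp (q (n - 1) t - q n t) - Real.exp (q n t - q (n + 1) t)) ∧
    (∀ t : ℝ, deriv (deriv (q (N - 1))) t
        = Real.exp (q (N - 2) t - q (N - 1) t))) := by
  intro r M Δ' C
  obtain ⟨L, rfl⟩ := Nat.exists_eq_add_of_le' (show 1 ≤ N by omega)
  let x : Fin (L + 1) → ℝ := fun i => E (i + 1)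
  let w : ℝ → Fin (L + 1) → ℝ := fun t i => r (i + 1) * Real.exp (x i * t)
  let μ : Fin (L + 1) → ℝ := fun i => r (i + 1) / ∏ j ∈ Finset.univ.erase i, (x i - x j)
  have hinter : ∀ s : Fin L, x s.castSucc < γ (s + 1) ∧ γ (s + 1) < x s.succ := fun s => by
    simpa [x] using hint (s + 1) (by omega) (by omega)
  have hx : Function.Injective x :=
    (Fin.strictMono_iff_lt_succ.2 fun s => (hinter s).1.trans (hinter s).2).injective
  have hμ : ∀ i, 0 < μ i := by
    intro i
    convert interlacing_weight_pos hinter i using 2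
    simp only [r, Nat.add_sub_cancel, x]
    rw [← Finset.Ico_add_one_right_eq_Icc, Finset.prod_Ico_eq_prod_range, Nat.add_sub_cancel,
      Finset.prod_range]
    simp only [add_comm]
  let m : ℕ → ℝ → ℝ := fun s t => discreteMoment x (fun i => μ i * Real.exp (x i * t)) s
  have hpos : ∀ k ≤ L + 1, ∀ t, 0 < (hankel (fun s => m s t) k).det := fun k hk t =>
    det_hankel_discreteMoment_pos hx (fun i => mul_pos (hμ i) (Real.exp_pos _)) hk
  have hderiv : ∀ s t, HasDerivAt (m s) (m (s + 1) t) t := hasDerivAt_discreteMoment_exp x μ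
  have hsplit : ∀ k ≤ L + 1, ∃ c : ℝ, |c| = |(lagrangeMatrix x).det| ∧ ∀ t,
      c * (splitVandermonde x (w t) k).det = (hankel (fun s => m s t) k).det := by
    intro k hk
    obtain ⟨c, hc, h⟩ := exists_mul_det_splitVandermonde hx hk
    refine ⟨c, hc, fun t => (h (w t)).trans ?_⟩
    simp only [m, w, μ, div_mul_eq_mul_div]
  have hΔ : ∀ n ≤ L, ∀ t, Δ' n t n = (splitVandermonde x (w t) n).det := by
    intro n hn t
    simp only [Δ']
    rw [dif_pos (by omega)]
    congr 1
    ext i j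
    simp only [M, submatrix_apply, of_apply, splitVandermonde, w, x, id]
    by_cases hj : (j : ℕ) < n
    · rw [Fin.succAbove_of_castSucc_lt _ _ (by simpa [Fin.lt_def] using hj)]
      simp [hj, hj.le]
    · rw [Fin.succAbove_of_le_castSucc _ _ (by simpa [Fin.le_def] using hj)]
      simp only [Fin.val_succ]
      rw [if_neg (by omega), if_neg hj, show (j : ℕ) + 1 - n - 1 = j - n by omega]
  have hΔlast : ∀ n ≤ L, ∀ t, Δ' (L + 1) t n = (splitVandermonde x (w t) (n + 1)).det := by
    intro n hn t
    simp only [Δ']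
    rw [dif_pos (by omega)]
    congr 1
    ext i j
    simp only [M, submatrix_apply, of_apply, splitVandermonde, w, x, id]
    rw [Fin.succAbove_of_castSucc_lt _ _ (by simp [Fin.lt_def]; omega)]
    simp only [Fin.val_castSucc, Nat.lt_succ_iff, Nat.sub_sub]
  refine open_toda_of_tau hN (H := fun k t => (hankel (fun s => m s t) k).det)
    (R := fun n t => Δ' n t n / Δ' (L + 1) t n) hpos
    (contDiff_det_hankel (contDiff_discreteMoment_exp x μ)) (fun t => by simp)
    (fun t => det_hankel_discreteMoment_eq_zero _ _ (by omega))
    (fun k hk => exists_hasDerivAt_log_det_hankel hderiv k (fun t => (hpos k hk.le t).ne')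
      fun t => (hpos (k + 1) hk t).ne') (fun n hn => ?_) C
  obtain ⟨c, hc, h⟩ := hsplit n (by omega)
  obtain ⟨c', hc', h'⟩ := hsplit (n + 1) (by omega)
  have hne : c ≠ 0 := left_ne_zero_of_mul ((h 0).trans_ne (hpos n hn.le 0).ne')
  have hne' : c' ≠ 0 := left_ne_zero_of_mul ((h' 0).trans_ne (hpos (n + 1) hn 0).ne')
  refine ⟨c' / c, ?_, fun t => ?_⟩
  · rw [abs_div, hc', ← hc, div_self (abs_ne_zero.2 hne)]
  · simp only [hΔ n (by omega), hΔlast n (by omega), ← h, ← h']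
    rw [div_mul_div_comm, mul_left_comm c', mul_div_mul_left _ _ hne, mul_div_mul_left _ _ hne']
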